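/- Let d ≥ 1 and let E ⊂ ℤ^d be a finite nonempty set contained in the ball B_∞(R) = {x ∈ ℝ^d : ‖x‖_∞ ≤ R} for some R ≥ 2. Then there is a constant C (depending only on d) such that for all 1 ≤ m ≤ |E| the best m-term trigonometric approximation of the Fourier projection satisfies σ_m(S_E : L₂(𝕋^d) → L_∞(𝕋^d)) ≤ C (|E| log R / m)^{1/2}. -/

import Mathlib

open MeasureTheory Real
open scoped ENNReal ComplexConjugate

noncomputable section

instance : Fact (0 < 2 * π) := ⟨by positivity⟩

/-- The `d`-dimensional torus `[0, 2π]^d`. -/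
abbrev Torus (d : ℕ) := Fin d → AddCircle (2 * π)

/-- The multivariate trigonometric character `x ↦ e^{i k · x}`. -/
def trigChar {d : ℕ} (k : Fin d → ℤ) : C(Torus d, ℂ) :=
  ⟨fun x => ∏ j, fourier (k j) (x j),
    continuous_finset_prod _ fun j _ => (map_continuous (fourier (k j))).comp (continuous_apply j)⟩

/-- The Fourier coefficient `f̂(k) = (2π)^{-d} ∫ f(x) e^{-i k·x} dx`. -/
def fCoeff {d : ℕ} (f : Torus d → ℂ) (k : Fin d → ℤ) : ℂ :=
  ((2 * π) ^ d)⁻¹ • ∫ x : Torus d, conj (trigChar k x) * f x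

/-- A continuous function on the torus, considered as an element of `L_∞`. -/
def toLinfty {d : ℕ} (g : C(Torus d, ℂ)) : Lp ℂ ∞ (volume : Measure (Torus d)) :=
  ContinuousMap.toLp ∞ (volume : Measure (Torus d)) ℂ g

/-- The Fourier projection `S_E f = ∑_{k ∈ E} f̂(k) e^{i k·x}`, as an operator from
`L_q(𝕋^d)` to `L_∞(𝕋^d)`. -/
def SE (d : ℕ) (q : ℝ≥0∞) (E : Finset (Fin d → ℤ))
    (f : Lp ℂ q (volume : Measure (Torus d))) : Lp ℂ ∞ (volume : Measure (Torus d)) :=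
  toLinfty (∑ k ∈ E, fCoeff (f : Torus d → ℂ) k • trigChar k)

/-- The set `Y_n` of trigonometric polynomials with at most `n` frequencies,
as a subset of `L_∞(𝕋^d)`. -/
def sparseTrig (d n : ℕ) : Set (Lp ℂ ∞ (volume : Measure (Torus d))) :=
  {g | ∃ Λ : Finset (Fin d → ℤ), Λ.card ≤ n ∧ ∃ c : (Fin d → ℤ) → ℂ,
    g = toLinfty (∑ k ∈ Λ, c k • trigChar k)}

/-- The `m`-th error of best approximation of a map `T : X → Y` with respect to
the sets `(Yn)`: `σ_m(T) = sup_{‖x‖ ≤ 1} inf_{y ∈ Y_{m-1}} ‖T x - y‖`. -/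
noncomputable def sigmaA {X Y : Type*} [Norm X] [NormedAddCommGroup Y]
    (T : X → Y) (Yn : ℕ → Set Y) (m : ℕ) : ℝ :=
  ⨆ x : {x : X // ‖x‖ ≤ 1}, ⨅ y : Yn (m - 1), ‖T x.1 - (y : Y)‖

section Sampling

open Finset

theorem sum_weighted_exp_le {ι : Type*} (s : Finset ι) (p u : ι → ℝ) (hp : ∀ k ∈ s, 0 ≤ p k)
    (hp1 : ∑ k ∈ s, p k = 1) (hu : ∀ k ∈ s, |u k| ≤ 1) (lam : ℝ) :
    ∑ k ∈ s, p k * Real.exp (lam * (u k - ∑ l ∈ s, p l * u l)) ≤ Real.exp (2 * lam ^ 2) := by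
  set μ := ∑ l ∈ s, p l * u l with hμ
  have hμ1 : |μ| ≤ 1 := by
    calc |μ| ≤ ∑ l ∈ s, |p l * u l| := abs_sum_le_sum_abs _ _
      _ ≤ ∑ l ∈ s, p l := sum_le_sum fun l hl => by
          rw [abs_mul, abs_of_nonneg (hp l hl)]
          exact mul_le_of_le_one_right (hp l hl) (hu l hl)
      _ = 1 := hp1
  calc ∑ k ∈ s, p k * Real.exp (lam * (u k - μ))
      ≤ ∑ k ∈ s, p k * (Real.cosh (2 * lam) + (u k - μ) / 2 * Real.sinh (2 * lam)) := by
        refine sum_le_sum fun k hk => mul_le_mul_of_nonneg_left ?_ (hp k hk)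
        have h : |(u k - μ) / 2| ≤ 1 := by
          have := abs_le.1 (hu k hk)
          have := abs_le.1 hμ1
          exact abs_le.2 ⟨by linarith, by linarith⟩
        have hexp := Real.exp_mul_le_cosh_add_mul_sinh h (2 * lam)
        rwa [show (u k - μ) / 2 * (2 * lam) = lam * (u k - μ) by ring] at hexp
    _ = Real.cosh (2 * lam) * ∑ k ∈ s, p k
        + Real.sinh (2 * lam) / 2 * (∑ k ∈ s, p k * u k - μ * ∑ k ∈ s, p k) := by
        simp only [mul_sum, ← sum_sub_distrib, ← sum_add_distrib]
        exact sum_congr rfl fun k _ => by ring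
    _ = Real.cosh (2 * lam) := by rw [hp1, ← hμ]; ring
    _ ≤ Real.exp (2 * lam ^ 2) := by
        refine (Real.cosh_le_exp_half_sq _).trans_eq (congrArg Real.exp ?_)
        ring

theorem exists_counts_sum_exp_le {ι κ : Type*} [DecidableEq ι] [Fintype κ] (s : Finset ι)
    (p : ι → ℝ) (u : ι → κ → ℝ) (hp : ∀ k ∈ s, 0 ≤ p k) (hp1 : ∑ k ∈ s, p k = 1)
    (hu : ∀ k ∈ s, ∀ x, |u k x| ≤ 1) (lam : ℝ) (n : ℕ) :
    ∃ a : ι → ℕ, ∑ k ∈ s, a k = n ∧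
      ∑ x, Real.exp (lam * (∑ k ∈ s, a k * u k x - n * ∑ k ∈ s, p k * u k x))
        ≤ Fintype.card κ * Real.exp (2 * lam ^ 2 * n) := by
  induction n with
  | zero => exact ⟨0, by simp⟩
  | succ n ih =>
    obtain ⟨a, ha, hΦ⟩ := ih
    set w : κ → ℝ := fun x => lam * (∑ k ∈ s, a k * u k x - n * ∑ k ∈ s, p k * u k x)
    set Φ : ι → ℝ := fun k => ∑ x, Real.exp (w x + lam * (u k x - ∑ l ∈ s, p l * u l x))
    have hne : s.Nonempty := by
      rw [nonempty_iff_ne_empty]; rintro rfl; simp at hp1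
    have havg : ∑ k ∈ s, p k * Φ k ≤
        ∑ k ∈ s, p k * (Fintype.card κ * Real.exp (2 * lam ^ 2 * (n + 1 : ℕ))) := by
      calc ∑ k ∈ s, p k * Φ k
          = ∑ x, Real.exp (w x) *
              ∑ k ∈ s, p k * Real.exp (lam * (u k x - ∑ l ∈ s, p l * u l x)) := by
            simp only [Φ, mul_sum, Real.exp_add]
            rw [sum_comm]
            exact sum_congr rfl fun x _ => sum_congr rfl fun k _ => by ring
        _ ≤ ∑ x, Real.exp (w x) * Real.exp (2 * lam ^ 2) :=
            sum_le_sum fun x _ => mul_le_mul_of_nonneg_left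
              (sum_weighted_exp_le s p (u · x) hp hp1 (fun k hk => hu k hk x) lam)
              (Real.exp_nonneg _)
        _ = (∑ x, Real.exp (w x)) * Real.exp (2 * lam ^ 2) := by rw [sum_mul]
        _ ≤ (Fintype.card κ * Real.exp (2 * lam ^ 2 * n)) * Real.exp (2 * lam ^ 2) := by gcongr
        _ = _ := by
            rw [← sum_mul, hp1, one_mul, mul_assoc, ← Real.exp_add]
            push_cast; ring_nf
    obtain ⟨k₀, hk₀, hle⟩ : ∃ k ∈ s, Φ k ≤
        Fintype.card κ * Real.exp (2 * lam ^ 2 * (n + 1 : ℕ)) := by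
      by_contra! hlt
      obtain ⟨k, hk, hkp⟩ : ∃ k ∈ s, 0 < p k := by
        by_contra! h
        linarith [sum_nonpos h]
      refine absurd havg (not_le.2 (sum_lt_sum
        (fun i hi => mul_le_mul_of_nonneg_left (hlt i hi).le (hp i hi)) ⟨k, hk, ?_⟩))
      exact mul_lt_mul_of_pos_left (hlt k hk) hkp
    refine ⟨fun k => a k + if k = k₀ then 1 else 0, ?_, hle.trans' (le_of_eq ?_)⟩
    · simp [sum_add_distrib, ha, hk₀]
    · refine sum_congr rfl fun x _ => congrArg Real.exp ?_
      have : ∑ k ∈ s, ((if k = k₀ then 1 else 0 : ℕ) : ℝ) * u k x = u k₀ x := by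
        simp [hk₀]
      simp only [w, Nat.cast_add, add_mul, sum_add_distrib, this]
      push_cast; ring

theorem exists_counts_deviation_le {ι κ : Type*} [DecidableEq ι] [Fintype κ] (s : Finset ι)
    (p : ι → ℝ) (u : ι → κ → ℝ) (hp : ∀ k ∈ s, 0 ≤ p k) (hp1 : ∑ k ∈ s, p k = 1)
    (hu : ∀ k ∈ s, ∀ x, |u k x| ≤ 1) (hκ : 1 < Fintype.card κ) {n : ℕ} (hn : 0 < n) :
    ∃ a : ι → ℕ, ∑ k ∈ s, a k = n ∧
      ∀ x, (∑ k ∈ s, a k * u k x) / n - ∑ k ∈ s, p k * u k x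
        ≤ 3 * Real.sqrt (Real.log (Fintype.card κ) / n) := by
  set L := Real.log (Fintype.card κ)
  have hL : 0 < L := Real.log_pos (by exact_mod_cast hκ)
  have hn' : (0 : ℝ) < n := by exact_mod_cast hn
  set lam := Real.sqrt (L / n)
  have hlam : 0 < lam := Real.sqrt_pos.2 (by positivity)
  have hsq : lam ^ 2 * n = L := by
    rw [Real.sq_sqrt (by positivity)]; field_simp
  obtain ⟨a, ha, h⟩ := exists_counts_sum_exp_le s p u hp hp1 hu lam n
  refine ⟨a, ha, fun x => ?_⟩
  have hx := (single_le_sum (f := fun x => Real.exp (lam *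
    (∑ k ∈ s, a k * u k x - n * ∑ k ∈ s, p k * u k x))) (fun _ _ => (Real.exp_pos _).le)
    (mem_univ x)).trans h
  have hc : (Fintype.card κ : ℝ) = Real.exp L :=
    (Real.exp_log (by exact_mod_cast (by omega : 0 < Fintype.card κ))).symm
  rw [hc, ← Real.exp_add, Real.exp_le_exp] at hx
  have hx' : lam * (n * ((∑ k ∈ s, a k * u k x) / n - ∑ k ∈ s, p k * u k x))
      ≤ lam * (n * (3 * lam)) := by
    calc _ = lam * (∑ k ∈ s, a k * u k x - n * ∑ k ∈ s, p k * u k x) := by field_simp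
      _ ≤ _ := hx
      _ = _ := by rw [← hsq]; ring
  exact le_of_mul_le_mul_left (le_of_mul_le_mul_left hx' hlam) hn'

theorem Complex.norm_le_of_re_I_pow_mul_le {z : ℂ} {r : ℝ}
    (h : ∀ j : Fin 4, (Complex.I ^ (j : ℕ) * z).re ≤ r) : ‖z‖ ≤ 2 * r := by
  have h0 := h 0
  have h1 := h 1
  have h2 := h 2
  have h3 := h 3
  simp [pow_succ] at h0 h1 h2 h3
  have := Complex.norm_le_abs_re_add_abs_im z
  have : |z.re| ≤ r := abs_le.2 ⟨by linarith, by linarith⟩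
  have : |z.im| ≤ r := abs_le.2 ⟨by linarith, by linarith⟩
  linarith

theorem exists_counts_norm_deviation_le {ι X : Type*} [DecidableEq ι] [Fintype X] [Nonempty X]
    (s : Finset ι) (p : ι → ℝ) (v : ι → X → ℂ) (hp : ∀ k ∈ s, 0 ≤ p k)
    (hp1 : ∑ k ∈ s, p k = 1) (hv : ∀ k ∈ s, ∀ x, ‖v k x‖ ≤ 1) {n : ℕ} (hn : 0 < n) :
    ∃ a : ι → ℕ, ∑ k ∈ s, a k = n ∧
      ∀ x, ‖∑ k ∈ s, ((p k - a k / n : ℝ) : ℂ) * v k x‖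
        ≤ 6 * Real.sqrt (Real.log (4 * Fintype.card X) / n) := by
  have hX : 0 < Fintype.card X := Fintype.card_pos
  have hcard : Fintype.card (X × Fin 4) = 4 * Fintype.card X := by simp [mul_comm]
  obtain ⟨a, ha, h⟩ := exists_counts_deviation_le s p
    (fun k (y : X × Fin 4) => (Complex.I ^ (y.2 : ℕ) * v k y.1).re) hp hp1
    (fun k hk y => (Complex.abs_re_le_norm _).trans (by simpa using hv k hk y.1))
    (by omega) hn
  refine ⟨a, ha, fun x => ?_⟩
  rw [hcard] at h
  push_cast at h
  rw [← norm_neg]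
  refine (Complex.norm_le_of_re_I_pow_mul_le fun j => ?_).trans_eq
    (by ring : 2 * (3 * Real.sqrt (Real.log (4 * Fintype.card X) / n)) = _)
  refine (h (x, j)).trans_eq' ?_
  rw [← sum_neg_distrib, mul_sum, Complex.re_sum, sum_div, ← sum_sub_distrib]
  refine sum_congr rfl fun k _ => ?_
  rw [show Complex.I ^ (j : ℕ) * -(((p k - a k / n : ℝ) : ℂ) * v k x)
    = ((a k / n - p k : ℝ) : ℂ) * (Complex.I ^ (j : ℕ) * v k x) by push_cast; ring,
    Complex.re_ofReal_mul]
  ring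

end Sampling

theorem trigChar_norm_le {d : ℕ} (k : Fin d → ℤ) (x : Torus d) : ‖trigChar k x‖ ≤ 1 := by
  simp only [trigChar, fourier_apply, ContinuousMap.coe_mk, norm_prod, Circle.norm_coe,
    Finset.prod_const_one, le_rfl]

theorem integral_conj_fourier_mul_fourier (m n : ℤ) :
    ∫ x : AddCircle (2 * π), conj (fourier m x) * fourier n x
      = if m = n then (2 * π : ℂ) else 0 := by
  have h := orthonormal_iff_ite.mp (orthonormal_fourier (T := 2 * π)) m n
  rw [fourierLp, fourierLp, ContinuousMap.inner_toLp, AddCircle.integral_haarAddCircle] at h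
  have hpi : (2 * π : ℂ) ≠ 0 := by exact_mod_cast (by positivity : (2 * π : ℝ) ≠ 0)
  rw [Complex.real_smul] at h
  push_cast at h
  rw [inv_mul_eq_iff_eq_mul₀ hpi] at h
  simpa [mul_comm] using h

theorem integral_conj_trigChar_mul_trigChar {d : ℕ} (k l : Fin d → ℤ) :
    ∫ x : Torus d, conj (trigChar k x) * trigChar l x
      = if k = l then ((2 * π) ^ d : ℂ) else 0 := by
  calc ∫ x : Torus d, conj (trigChar k x) * trigChar l x
      = ∫ x : Torus d, ∏ j, (conj (fourier (k j) (x j)) * fourier (l j) (x j)) := by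
        simp [trigChar, Finset.prod_mul_distrib]
    _ = ∏ j, ∫ x : AddCircle (2 * π), conj (fourier (k j) x) * fourier (l j) x :=
        integral_fintype_prod_volume_eq_prod
          (fun j (x : AddCircle (2 * π)) => conj (fourier (k j) x) * fourier (l j) x)
    _ = _ := by
        simp only [integral_conj_fourier_mul_fourier]
        split_ifs with h
        · simp [h]
        · obtain ⟨j, hj⟩ := Function.ne_iff.1 h
          exact Finset.prod_eq_zero (Finset.mem_univ j) (if_neg hj)

/-- The normalized characters as elements of `L₂(𝕋^d)`. -/
def trigCharL2 {d : ℕ} (k : Fin d → ℤ) : Lp ℂ 2 (volume : Measure (Torus d)) :=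
  ((√((2 * π) ^ d) : ℝ) : ℂ)⁻¹ •
    ContinuousMap.toLp 2 (volume : Measure (Torus d)) ℂ (trigChar k)

theorem orthonormal_trigCharL2 (d : ℕ) : Orthonormal ℂ (trigCharL2 (d := d)) := by
  rw [orthonormal_iff_ite]
  intro k l
  have hs : ((√((2 * π) ^ d) : ℝ) : ℂ) * ((√((2 * π) ^ d) : ℝ) : ℂ) = (2 * π) ^ d := by
    rw [← Complex.ofReal_mul, Real.mul_self_sqrt (by positivity)]
    push_cast; rfl
  have h0 : ((2 * π) ^ d : ℂ) ≠ 0 := by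
    exact_mod_cast (by positivity : ((2 * π) ^ d : ℝ) ≠ 0)
  rw [trigCharL2, trigCharL2, inner_smul_left, inner_smul_right, ContinuousMap.inner_toLp,
    ← mul_assoc, map_inv₀, Complex.conj_ofReal, ← mul_inv, hs]
  simp_rw [mul_comm (trigChar l _)]
  rw [integral_conj_trigChar_mul_trigChar]
  split_ifs <;> simp [h0]

theorem norm_fCoeff_le_norm_inner {d : ℕ} (f : Lp ℂ 2 (volume : Measure (Torus d)))
    (k : Fin d → ℤ) : ‖fCoeff (f : Torus d → ℂ) k‖ ≤ ‖inner ℂ (trigCharL2 k) f‖ := by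
  have hV : (1 : ℝ) ≤ (2 * π) ^ d := one_le_pow₀ (by linarith [Real.two_le_pi])
  have hint : inner ℂ (ContinuousMap.toLp 2 (volume : Measure (Torus d)) ℂ (trigChar k)) f
      = ∫ x : Torus d, conj (trigChar k x) * f x := by
    rw [L2.inner_def]
    refine integral_congr_ae ?_
    filter_upwards [ContinuousMap.coeFn_toLp (p := 2) (𝕜 := ℂ) (volume : Measure (Torus d))
      (trigChar k)] with x hx
    rw [hx, RCLike.inner_apply, mul_comm]
  rw [trigCharL2, inner_smul_left, hint, fCoeff, norm_smul, norm_mul]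
  refine mul_le_mul_of_nonneg_right ?_ (norm_nonneg _)
  rw [map_inv₀, Complex.conj_ofReal, norm_inv, norm_inv, Complex.norm_real,
    Real.norm_of_nonneg (by positivity), Real.norm_of_nonneg (by positivity)]
  refine inv_anti₀ (by positivity) ?_
  exact Real.sqrt_le_iff.2 ⟨by positivity, by nlinarith⟩

theorem sum_norm_fCoeff_le {d : ℕ} (f : Lp ℂ 2 (volume : Measure (Torus d))) (hf : ‖f‖ ≤ 1)
    (E : Finset (Fin d → ℤ)) : ∑ k ∈ E, ‖fCoeff (f : Torus d → ℂ) k‖ ≤ √E.card := by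
  refine Real.le_sqrt_of_sq_le ?_
  calc (∑ k ∈ E, ‖fCoeff (f : Torus d → ℂ) k‖) ^ 2
      ≤ E.card * ∑ k ∈ E, ‖fCoeff (f : Torus d → ℂ) k‖ ^ 2 := sq_sum_le_card_mul_sum_sq
    _ ≤ E.card * ∑ k ∈ E, ‖inner ℂ (trigCharL2 k) f‖ ^ 2 := by
        gcongr with k _
        exact norm_fCoeff_le_norm_inner f k
    _ ≤ E.card * ‖f‖ ^ 2 := by
        gcongr
        exact (orthonormal_trigCharL2 d).sum_inner_products_le f
    _ ≤ E.card := mul_le_of_le_one_right (by positivity) (pow_le_one₀ (norm_nonneg _) hf)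

theorem norm_toLinfty_le {d : ℕ} (g : C(Torus d, ℂ)) {r : ℝ} (hr : 0 ≤ r)
    (h : ∀ x, ‖g x‖ ≤ r) : ‖toLinfty g‖ ≤ r := by
  refine (Lp.norm_le_of_ae_bound hr ?_).trans_eq (by simp)
  filter_upwards [ContinuousMap.coeFn_toLp (p := ∞) (𝕜 := ℂ) (volume : Measure (Torus d)) g]
    with x hx
  rw [toLinfty, hx]
  exact h x

/-- The point `(2π a_j / M)_j` of the uniform grid on the torus. -/
def gridPoint {d M : ℕ} (a : Fin d → Fin M) : Torus d :=
  fun j => ((2 * π * (a j : ℕ) / M : ℝ) : AddCircle (2 * π))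

theorem trigChar_coe {d : ℕ} (k : Fin d → ℤ) (t : Fin d → ℝ) :
    trigChar k (fun j => (t j : AddCircle (2 * π)))
      = Complex.exp (Complex.I * ((∑ j, k j * t j : ℝ) : ℂ)) := by
  have hpi : (π : ℂ) ≠ 0 := by exact_mod_cast Real.pi_ne_zero
  simp only [trigChar, ContinuousMap.coe_mk, fourier_coe_apply, ← Complex.exp_sum]
  congr 1
  push_cast
  rw [Finset.mul_sum]
  refine Finset.sum_congr rfl fun j _ => ?_
  field_simp

theorem norm_trigChar_coe_sub_le {d : ℕ} (k : Fin d → ℤ) (t s : Fin d → ℝ) :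
    ‖trigChar k (fun j => (t j : AddCircle (2 * π))) -
      trigChar k (fun j => (s j : AddCircle (2 * π)))‖ ≤ ∑ j, |(k j : ℝ)| * |t j - s j| := by
  have h : trigChar k (fun j => (t j : AddCircle (2 * π))) -
      trigChar k (fun j => (s j : AddCircle (2 * π)))
      = Complex.exp (Complex.I * ((∑ j, k j * s j : ℝ) : ℂ)) *
        (Complex.exp (Complex.I * ((∑ j, k j * (t j - s j) : ℝ) : ℂ)) - 1) := by
    have hsum : ∑ j, k j * t j = ∑ j, k j * s j + ∑ j, k j * (t j - s j) := by
      rw [← Finset.sum_add_distrib]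
      exact Finset.sum_congr rfl fun j _ => by ring
    rw [trigChar_coe, trigChar_coe, mul_sub, ← Complex.exp_add, mul_one, ← mul_add,
      ← Complex.ofReal_add, ← hsum]
  rw [h, norm_mul, mul_comm Complex.I, Complex.norm_exp_ofReal_mul_I, one_mul]
  refine Real.norm_exp_I_mul_ofReal_sub_one_le.trans ((Finset.abs_sum_le_sum_abs _ _).trans_eq ?_)
  exact Finset.sum_congr rfl fun j _ => abs_mul _ _

theorem exists_gridPoint_norm_sub_le {d M : ℕ} (hM : 0 < M) (x : Torus d) :
    ∃ a : Fin d → Fin M, ∀ (R : ℝ) (k : Fin d → ℤ), (∀ j, |(k j : ℝ)| ≤ R) →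
      ‖trigChar k x - trigChar k (gridPoint a)‖ ≤ d * (R * (2 * π / M)) := by
  have hM' : (0 : ℝ) < M := by exact_mod_cast hM
  have hex : ∀ j, ∃ t : ℝ, (0 ≤ t ∧ t < 2 * π) ∧ (t : AddCircle (2 * π)) = x j := fun j => by
    obtain ⟨t, ht, h⟩ := AddCircle.coe_image_Ico_eq (2 * π) 0 ▸ Set.mem_univ (x j)
    exact ⟨t, by simpa using ht, h⟩
  choose t ht hx using hex
  have hpi := Real.pi_pos
  have hfl : ∀ j, ⌊t j * M / (2 * π)⌋₊ < M := fun j => by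
    rw [Nat.floor_lt (by have := (ht j).1; positivity), div_lt_iff₀ (by positivity), mul_comm]
    exact mul_lt_mul_of_pos_left (ht j).2 hM'
  refine ⟨fun j => ⟨_, hfl j⟩, fun R k hk => ?_⟩
  obtain rfl : (fun j => (t j : AddCircle (2 * π))) = x := funext hx
  refine (norm_trigChar_coe_sub_le k t _).trans ?_
  have : ∀ j ∈ Finset.univ, |(k j : ℝ)| * |t j - 2 * π * (⌊t j * M / (2 * π)⌋₊ : ℕ) / M|
      ≤ R * (2 * π / M) := fun j _ => by
    refine mul_le_mul (hk j) ?_ (abs_nonneg _) ((abs_nonneg _).trans (hk j))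
    have h1 := Nat.floor_le (a := t j * M / (2 * π)) (by have := (ht j).1; positivity)
    have h2 := Nat.lt_floor_add_one (t j * M / (2 * π))
    have he : t j - 2 * π * (⌊t j * M / (2 * π)⌋₊ : ℕ) / M
        = (2 * π / M) * (t j * M / (2 * π) - (⌊t j * M / (2 * π)⌋₊ : ℕ)) := by
      field_simp
    rw [he, abs_mul, abs_of_pos (by positivity)]
    exact mul_le_of_le_one_right (by positivity) (abs_le.2 ⟨by linarith, by linarith⟩)
  simpa using Finset.sum_le_card_nsmul _ _ _ this

theorem exists_sparse_approx {d : ℕ} (E : Finset (Fin d → ℤ)) {R : ℝ}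
    (hE : ∀ k ∈ E, ∀ j, |(k j : ℝ)| ≤ R) (c : (Fin d → ℤ) → ℂ) {n M : ℕ} (hn : 0 < n)
    (hM : 0 < M) :
    ∃ Λ : Finset (Fin d → ℤ), Λ.card ≤ n ∧ ∃ b : (Fin d → ℤ) → ℂ, ∀ x,
      ‖(∑ k ∈ E, c k • trigChar k - ∑ k ∈ Λ, b k • trigChar k) x‖
        ≤ (∑ k ∈ E, ‖c k‖) *
          (6 * √(Real.log (4 * M ^ d) / n) + 2 * (d * (R * (2 * π / M)))) := by
  classical
  set A := ∑ k ∈ E, ‖c k‖ with hA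
  have hA0 : 0 ≤ A := Finset.sum_nonneg fun _ _ => norm_nonneg _
  obtain hz | hpos := hA0.eq_or_lt
  · refine ⟨∅, by simp, 0, fun x => ?_⟩
    have hc := (Finset.sum_eq_zero_iff_of_nonneg fun k _ => norm_nonneg (c k)).1 (hA ▸ hz.symm)
    rw [Finset.sum_eq_zero fun k hk => by rw [norm_eq_zero.1 (hc k hk), zero_smul], ← hz]
    simp
  have hn' : (0 : ℝ) < n := by exact_mod_cast hn
  have : Nonempty (Fin M) := ⟨⟨0, hM⟩⟩
  set θ : (Fin d → ℤ) → ℂ := fun k => c k / ‖c k‖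
  have hθ : ∀ k, ‖θ k‖ ≤ 1 := fun k => by
    simpa [θ] using div_self_le_one ‖c k‖
  have hcθ : ∀ k, c k = ‖c k‖ * θ k := fun k => by
    rcases eq_or_ne (c k) 0 with h | h
    · simp [h]
    · have : (‖c k‖ : ℂ) ≠ 0 := by simpa using h
      simp only [θ]; field_simp
  have hp1 : ∑ k ∈ E, ‖c k‖ / A = 1 := by rw [← Finset.sum_div, ← hA, div_self hpos.ne']
  obtain ⟨a, ha, hdev⟩ := exists_counts_norm_deviation_le E (fun k => ‖c k‖ / A)
    (fun k (y : Fin d → Fin M) => θ k * trigChar k (gridPoint y))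
    (fun k _ => by positivity) hp1
    (fun k _ y => by
      rw [norm_mul]
      exact mul_le_one₀ (hθ k) (norm_nonneg _) (trigChar_norm_le k _)) hn
  set w : (Fin d → ℤ) → ℂ := fun k => ((‖c k‖ / A - a k / n : ℝ) : ℂ)
  have hw : ∑ k ∈ E, ‖w k‖ ≤ 2 := by
    calc ∑ k ∈ E, ‖w k‖ ≤ ∑ k ∈ E, (‖c k‖ / A + a k / n) := Finset.sum_le_sum fun k _ => by
          rw [Complex.norm_real, Real.norm_eq_abs]
          refine (abs_sub _ _).trans_eq ?_
          rw [abs_of_nonneg (by positivity), abs_of_nonneg (by positivity)]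
      _ = 2 := by
          rw [Finset.sum_add_distrib, hp1, ← Finset.sum_div, ← Nat.cast_sum, ha,
            div_self hn'.ne']
          norm_num
  refine ⟨E.filter (a · ≠ 0), ?_, fun k => (A * (a k / n) : ℝ) * θ k, fun x => ?_⟩
  · calc (E.filter (a · ≠ 0)).card = ∑ k ∈ E.filter (a · ≠ 0), 1 := Finset.card_eq_sum_ones _
      _ ≤ ∑ k ∈ E.filter (a · ≠ 0), a k := Finset.sum_le_sum fun k hk =>
          Nat.one_le_iff_ne_zero.2 (Finset.mem_filter.1 hk).2
      _ ≤ ∑ k ∈ E, a k := Finset.sum_le_sum_of_subset (Finset.filter_subset _ _)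
      _ = n := ha
  have hrep : (∑ k ∈ E, c k • trigChar k -
      ∑ k ∈ E.filter (a · ≠ 0), (((A * (a k / n) : ℝ) : ℂ) * θ k) • trigChar k) x
      = A * ∑ k ∈ E, w k * (θ k * trigChar k x) := by
    rw [Finset.sum_filter_of_ne (fun k _ h => by contrapose! h; simp [h]),
      ← Finset.sum_sub_distrib,
      ContinuousMap.sum_apply, Finset.mul_sum]
    refine Finset.sum_congr rfl fun k _ => ?_
    have hAc : (A : ℂ) ≠ 0 := by exact_mod_cast hpos.ne'
    nth_rw 1 [hcθ k]
    simp only [ContinuousMap.sub_apply, ContinuousMap.smul_apply, smul_eq_mul, w]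
    push_cast
    field_simp
  obtain ⟨y, hy⟩ := exists_gridPoint_norm_sub_le hM x
  rw [hrep, norm_mul, Complex.norm_real, Real.norm_of_nonneg hA0]
  refine mul_le_mul_of_nonneg_left ?_ hA0
  have hsplit : ∑ k ∈ E, w k * (θ k * trigChar k x)
      = ∑ k ∈ E, w k * (θ k * trigChar k (gridPoint y))
        + ∑ k ∈ E, w k * (θ k * (trigChar k x - trigChar k (gridPoint y))) := by
    rw [← Finset.sum_add_distrib]
    exact Finset.sum_congr rfl fun k _ => by ring
  rw [hsplit]
  refine (norm_add_le _ _).trans (add_le_add ?_ ?_)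
  · simpa [w] using hdev y
  · have hne : 0 ≤ (d : ℝ) * (R * (2 * π / M)) := by
      obtain ⟨k, hk⟩ : E.Nonempty := by
        rw [Finset.nonempty_iff_ne_empty]; rintro h; simp [h] at hp1
      exact (norm_nonneg _).trans (hy R k (hE k hk))
    calc ‖∑ k ∈ E, w k * (θ k * (trigChar k x - trigChar k (gridPoint y)))‖
        ≤ ∑ k ∈ E, ‖w k‖ * (d * (R * (2 * π / M))) := by
          refine (norm_sum_le _ _).trans (Finset.sum_le_sum fun k hk => ?_)
          rw [norm_mul, norm_mul]
          refine mul_le_mul_of_nonneg_left ?_ (norm_nonneg _)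
          exact (mul_le_of_le_one_left (norm_nonneg _) (hθ k)).trans (hy R k (hE k hk))
      _ ≤ 2 * (d * (R * (2 * π / M))) := by
          rw [← Finset.sum_mul]
          exact mul_le_mul_of_nonneg_right hw hne

theorem card_le_three_mul_pow {d : ℕ} {E : Finset (Fin d → ℤ)} {R : ℝ} (hR : 2 ≤ R)
    (hE : ∀ k ∈ E, ∀ j, |(k j : ℝ)| ≤ R) : (E.card : ℝ) ≤ (3 * R) ^ d := by
  have hsub : E ⊆ Fintype.piFinset fun _ => Finset.Icc (-⌊R⌋) ⌊R⌋ := fun k hk => by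
    refine Fintype.mem_piFinset.2 fun j => Finset.mem_Icc.2 ?_
    have h := abs_le.1 (hE k hk j)
    refine ⟨neg_le.1 (Int.le_floor.2 ?_), Int.le_floor.2 h.2⟩
    push_cast
    linarith
  have hfl : (0 : ℤ) ≤ ⌊R⌋ := Int.floor_nonneg.2 (by linarith)
  have hcard : ((Finset.Icc (-⌊R⌋) ⌊R⌋).card : ℝ) ≤ 3 * R := by
    have h1 : ((Finset.Icc (-⌊R⌋) ⌊R⌋).card : ℤ) = 2 * ⌊R⌋ + 1 := by
      rw [Int.card_Icc, Int.toNat_of_nonneg (by linarith)]; ring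
    have h2 : ((Finset.Icc (-⌊R⌋) ⌊R⌋).card : ℝ) = 2 * ⌊R⌋ + 1 := by exact_mod_cast h1
    linarith [Int.floor_le R]
  calc (E.card : ℝ) ≤ ((Fintype.piFinset fun _ : Fin d => Finset.Icc (-⌊R⌋) ⌊R⌋).card : ℝ) := by
        exact_mod_cast Finset.card_le_card hsub
    _ = ((Finset.Icc (-⌊R⌋) ⌊R⌋).card : ℝ) ^ d := by simp [Fintype.card_piFinset]
    _ ≤ (3 * R) ^ d := by gcongr

theorem half_le_log {R : ℝ} (hR : 2 ≤ R) : 1 / 2 ≤ Real.log R := by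
  linarith [Real.log_two_gt_d9, Real.log_le_log (by norm_num) hR]

/-- A mesh fine enough for discretizing polynomials with frequencies in `B_∞(R)`, with a number
of points polynomial in `R`. -/
theorem exists_mesh {d : ℕ} {R : ℝ} (hR : 2 ≤ R) :
    ∃ M : ℕ, 0 < M ∧ Real.log (4 * M ^ d) ≤ (2 + d * (7 + 4 * d)) * Real.log R ∧
      ∀ m : ℕ, 1 ≤ m → (m : ℝ) ≤ (3 * R) ^ d →
        2 * (d * (R * (2 * π / M))) ≤ √(Real.log R / m) := by
  have hR1 : 1 ≤ R := by linarith
  refine ⟨⌈R ^ (6 + 4 * d)⌉₊, Nat.ceil_pos.2 (by positivity), ?_, fun m hm hmR => ?_⟩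
  · have hM : (⌈R ^ (6 + 4 * d)⌉₊ : ℝ) ≤ R ^ (7 + 4 * d) := by
      have h1 : 1 ≤ R ^ (6 + 4 * d) := one_le_pow₀ hR1
      have h2 := (Nat.ceil_lt_add_one (a := R ^ (6 + 4 * d)) (by positivity)).le
      calc (⌈R ^ (6 + 4 * d)⌉₊ : ℝ) ≤ R ^ (6 + 4 * d) * 2 := by linarith
        _ ≤ R ^ (6 + 4 * d) * R := by gcongr
        _ = R ^ (7 + 4 * d) := by ring
    have hM0 : (0 : ℝ) < ⌈R ^ (6 + 4 * d)⌉₊ := by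
      exact_mod_cast Nat.ceil_pos.2 (by positivity)
    calc Real.log (4 * (⌈R ^ (6 + 4 * d)⌉₊ : ℝ) ^ d)
        ≤ Real.log (R ^ 2 * (R ^ (7 + 4 * d)) ^ d) := by
          refine Real.log_le_log (by positivity) ?_
          gcongr
          nlinarith
      _ = (2 + d * (7 + 4 * d)) * Real.log R := by
          rw [← pow_mul, ← pow_add, Real.log_pow]
          push_cast; ring
  · set M := ⌈R ^ (6 + 4 * d)⌉₊
    have hm0 : (0 : ℝ) < m := by exact_mod_cast hm
    have hM : R ^ (6 + 4 * d) ≤ M := Nat.le_ceil _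
    have hM0 : (0 : ℝ) < M := hM.trans_lt' (by positivity)
    have h3R : 1 ≤ (3 * R) ^ d := one_le_pow₀ (by linarith)
    have hlow : 1 / (2 * (3 * R) ^ d) ≤ √(Real.log R / m) := by
      refine Real.le_sqrt_of_sq_le ?_
      calc (1 / (2 * (3 * R) ^ d)) ^ 2 = 1 / 4 / ((3 * R) ^ d * (3 * R) ^ d) := by ring
        _ ≤ 1 / 2 / ((3 * R) ^ d * 1) := by gcongr; norm_num
        _ ≤ Real.log R / m := by
            rw [mul_one]
            exact div_le_div₀ (by linarith [half_le_log hR]) (half_le_log hR) hm0 hmR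
    refine hlow.trans' ?_
    have hd : (d : ℝ) ≤ R ^ d := by
      calc (d : ℝ) ≤ 2 ^ d := by exact_mod_cast d.lt_two_pow_self.le
        _ ≤ R ^ d := by gcongr
    have h3 : (3 * R) ^ d ≤ R ^ (3 * d) := by
      rw [pow_mul]
      gcongr
      nlinarith [mul_self_nonneg (R - 2)]
    have h8 : 8 * π ≤ R ^ 5 := by
      calc 8 * π ≤ 2 ^ 5 := by linarith [Real.pi_le_four]
        _ ≤ R ^ 5 := by gcongr
    rw [le_div_iff₀ (by positivity)]
    calc 2 * (d * (R * (2 * π / M))) * (2 * (3 * R) ^ d)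
        = (8 * π) * d * R * (3 * R) ^ d / M := by ring
      _ ≤ R ^ 5 * R ^ d * R * R ^ (3 * d) / M := by gcongr
      _ = R ^ (6 + 4 * d) / M := by ring
      _ ≤ 1 := div_le_one_of_le₀ hM hM0.le

theorem stmt10 (d : ℕ) (hd : 1 ≤ d) :
    ∃ C : ℝ, 0 < C ∧ ∀ R : ℝ, 2 ≤ R → ∀ E : Finset (Fin d → ℤ), E.Nonempty →
      (∀ k ∈ E, ∀ j, |(k j : ℝ)| ≤ R) →
      ∀ m : ℕ, 1 ≤ m → m ≤ E.card →
      sigmaA (SE d 2 E) (sparseTrig d) m ≤ C * Real.sqrt ((E.card * Real.log R) / m) := by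
  set K : ℝ := 2 + d * (7 + 4 * d)
  have hK0 : 0 ≤ K := by positivity
  refine ⟨6 * √(2 * K) + 2, by positivity, fun R hR E _ hE m hm hmE => ?_⟩
  have hlog := half_le_log hR
  have hm0 : (0 : ℝ) < m := by exact_mod_cast hm
  set ρ := Real.log R / m with hρ
  have hρ0 : 0 ≤ ρ := by positivity
  rw [mul_div_assoc, Real.sqrt_mul (Nat.cast_nonneg _)]
  refine Real.iSup_le (fun f => ?_) (by positivity)
  have hA := sum_norm_fCoeff_le f.1 f.2 E
  suffices h : ∃ y ∈ sparseTrig d (m - 1),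
      ‖SE d 2 E f.1 - y‖ ≤ (6 * √(2 * K) + 2) * (√E.card * √ρ) by
    obtain ⟨y, hy, hle⟩ := h
    exact (ciInf_le ⟨0, Set.forall_mem_range.2 fun _ => norm_nonneg _⟩
      (⟨y, hy⟩ : sparseTrig d (m - 1))).trans hle
  obtain rfl | hm2 := hm.eq_or_lt
  · refine ⟨0, ⟨∅, by simp, 0, by simp [toLinfty]⟩, ?_⟩
    rw [sub_zero]
    have hsρ : 1 ≤ 2 * √ρ := by
      have : 1 / 2 ≤ √ρ := Real.le_sqrt_of_sq_le (by
        rw [hρ, Nat.cast_one, div_one]; linarith)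
      linarith
    refine norm_toLinfty_le _ (by positivity) fun x => ?_
    calc ‖(∑ k ∈ E, fCoeff f.1 k • trigChar k) x‖
        ≤ ∑ k ∈ E, ‖fCoeff f.1 k‖ := by
          rw [ContinuousMap.sum_apply]
          refine (norm_sum_le _ _).trans (Finset.sum_le_sum fun k _ => ?_)
          rw [ContinuousMap.smul_apply, norm_smul]
          exact mul_le_of_le_one_right (norm_nonneg _) (trigChar_norm_le k x)
      _ ≤ √E.card * 1 := by rwa [mul_one]
      _ ≤ √E.card * (2 * √ρ) := by gcongr
      _ = 2 * (√E.card * √ρ) := by ring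
      _ ≤ (6 * √(2 * K) + 2) * (√E.card * √ρ) := by
          gcongr
          linarith [Real.sqrt_nonneg (2 * K)]
  · obtain ⟨M, hM, hMlog, hmesh⟩ := exists_mesh (d := d) hR
    have hmR : (m : ℝ) ≤ (3 * R) ^ d :=
      (card_le_three_mul_pow hR hE).trans' (by exact_mod_cast hmE)
    obtain ⟨Λ, hΛ, b, hb⟩ := exists_sparse_approx E hE (fCoeff f.1)
      (n := m - 1) (by omega) hM
    refine ⟨_, ⟨Λ, hΛ, b, rfl⟩, ?_⟩
    rw [SE, toLinfty, toLinfty, ← map_sub]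
    refine norm_toLinfty_le _ (by positivity) fun x => (hb x).trans ?_
    have hsqrt : √(Real.log (4 * M ^ d) / (m - 1 : ℕ)) ≤ √(2 * K) * √ρ := by
      rw [← Real.sqrt_mul (by positivity)]
      refine Real.sqrt_le_sqrt ?_
      have hhalf : (m : ℝ) / 2 ≤ (m - 1 : ℕ) := by
        have : (m : ℝ) ≤ 2 * (m - 1 : ℕ) := by exact_mod_cast (by omega : m ≤ 2 * (m - 1))
        linarith
      calc Real.log (4 * M ^ d) / (m - 1 : ℕ) ≤ K * Real.log R / (m / 2) :=
            div_le_div₀ (by positivity) hMlog (by positivity) hhalf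
        _ = 2 * K * ρ := by rw [hρ]; field_simp
    calc _ ≤ √E.card * (6 * (√(2 * K) * √ρ) + √ρ) := by
          refine mul_le_mul hA (add_le_add (by gcongr) (hmesh m hm hmR)) ?_ (by positivity)
          positivity
      _ = (6 * √(2 * K) + 1) * (√E.card * √ρ) := by ring
      _ ≤ (6 * √(2 * K) + 2) * (√E.card * √ρ) := by gcongr; norm_num

end
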